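/- arXiv:2501.11429 — 2 statements merged into one kernel-verified Lean document; each statement's English description precedes it below -/
import Mathlib

section
/- Let F be a finite set of features with model π, instance v and similarity relations as above. A feature i ∈ F is relevant (i.e., i belongs to at least one AXp) if and only if there exists a set S ⊆ F\{i} such that S ∪ {i} is a WAXp and S is not a WAXp (i.e., i is critical for some set S). -/
open Finset

/-- A set `S` of features is a weak abductive explanation (WAXp): for every point `x`
of feature space, if `x` is similar to `v` on all features in `S`, then the model
output at `x` is similar to the output at `v`. -/
def WAXp {m : ℕ} {D : Fin m → Type*} {T : Type*}
    (π : (∀ i, D i) → T) (v : ∀ i, D i)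
    (simD : ∀ i, D i → D i → Prop) (simT : T → T → Prop)
    (S : Finset (Fin m)) : Prop :=
  ∀ x : ∀ i, D i, (∀ i ∈ S, simD i (x i) (v i)) → simT (π x) (π v)

/-- An AXp is a subset-minimal WAXp. -/
def AXp {m : ℕ} {D : Fin m → Type*} {T : Type*}
    (π : (∀ i, D i) → T) (v : ∀ i, D i)
    (simD : ∀ i, D i → D i → Prop) (simT : T → T → Prop)
    (S : Finset (Fin m)) : Prop :=
  WAXp π v simD simT S ∧ ∀ S' ⊂ S, ¬ WAXp π v simD simT S'

/-- The characteristic function `ν_a`: takes value 1 on WAXps and 0 otherwise. -/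
noncomputable def nuA {m : ℕ} {D : Fin m → Type*} {T : Type*}
    (π : (∀ i, D i) → T) (v : ∀ i, D i)
    (simD : ∀ i, D i → D i → Prop) (simT : T → T → Prop)
    (S : Finset (Fin m)) : ℝ := by
  classical exact if WAXp π v simD simT S then 1 else 0

/-- Every superset of a WAXp is a WAXp. -/
theorem WAXp.mono {m : ℕ} {D : Fin m → Type*} {T : Type*}
    {π : (∀ i, D i) → T} {v : ∀ i, D i}
    {simD : ∀ i, D i → D i → Prop} {simT : T → T → Prop}
    {S S' : Finset (Fin m)} (h : WAXp π v simD simT S) (hS : S ⊆ S') :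
    WAXp π v simD simT S' :=
  fun x hx => h x fun i hi => hx i (hS hi)

/-- Every WAXp contains an AXp. -/
theorem WAXp.exists_axp_subset {m : ℕ} {D : Fin m → Type*} {T : Type*}
    {π : (∀ i, D i) → T} {v : ∀ i, D i}
    {simD : ∀ i, D i → D i → Prop} {simT : T → T → Prop}
    {S : Finset (Fin m)} (h : WAXp π v simD simT S) :
    ∃ A ⊆ S, AXp π v simD simT A := by
  induction S using Finset.strongInduction with
  | H S ih =>
    by_cases hmin : ∀ S' ⊂ S, ¬ WAXp π v simD simT S'
    · exact ⟨S, Finset.Subset.refl S, h, hmin⟩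
    · push Not at hmin
      obtain ⟨S', hS', hw⟩ := hmin
      obtain ⟨A, hA, hAXp⟩ := ih S' hS' hw
      exact ⟨A, hA.trans hS'.subset, hAXp⟩

/-- a feature is relevant (belongs to some AXp) iff it is critical for
some set `S ⊆ F \ {i}`, i.e. `S ∪ {i}` is a WAXp and `S` is not. -/
theorem relevant_iff_critical {m : ℕ} {D : Fin m → Type*} {T : Type*}
    (π : (∀ i, D i) → T) (v : ∀ i, D i)
    (simD : ∀ i, D i → D i → Prop) (simT : T → T → Prop)
    (i : Fin m) :
    (∃ A : Finset (Fin m), AXp π v simD simT A ∧ i ∈ A) ↔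
      (∃ S : Finset (Fin m), i ∉ S ∧
        WAXp π v simD simT (insert i S) ∧ ¬ WAXp π v simD simT S) := by
  constructor
  · rintro ⟨A, ⟨hA, hmin⟩, hi⟩
    refine ⟨A.erase i, Finset.notMem_erase i A, ?_, hmin _ (Finset.erase_ssubset hi)⟩
    rwa [Finset.insert_erase hi]
  · rintro ⟨S, -, hS, hnS⟩
    obtain ⟨A, hAS, hA⟩ := hS.exists_axp_subset
    refine ⟨A, hA, ?_⟩
    by_contra hi
    exact hnS (hA.1.mono ((Finset.subset_insert_iff_of_notMem hi).1 hAS))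
end

section
/- Let F be a finite set of features with model π, instance v and similarity relations as above. Every relevant feature is included in at least one CXp: if a feature i ∈ F belongs to some AXp, then there exists a CXp (a subset-minimal WCXp) that contains i. -/
open Finset

/-- A set `S` of features is a weak contrastive explanation (WCXp): there is a point
`x` of feature space similar to `v` on all features outside `S`, whose output is
not similar to the output at `v`. -/
def WCXp {m : ℕ} {D : Fin m → Type*} {T : Type*}
    (π : (∀ i, D i) → T) (v : ∀ i, D i)
    (simD : ∀ i, D i → D i → Prop) (simT : T → T → Prop)
    (S : Finset (Fin m)) : Prop :=
  ∃ x : ∀ i, D i, (∀ i ∈ Finset.univ \ S, simD i (x i) (v i)) ∧ ¬ simT (π x) (π v)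

/-- A CXp is a subset-minimal WCXp. -/
def CXp {m : ℕ} {D : Fin m → Type*} {T : Type*}
    (π : (∀ i, D i) → T) (v : ∀ i, D i)
    (simD : ∀ i, D i → D i → Prop) (simT : T → T → Prop)
    (S : Finset (Fin m)) : Prop :=
  WCXp π v simD simT S ∧ ∀ S' ⊂ S, ¬ WCXp π v simD simT S'

/-- every relevant feature (one belonging to some AXp) is included in
at least one CXp. -/
theorem relevant_mem_some_cxp {m : ℕ} {D : Fin m → Type*} {T : Type*}
    (π : (∀ i, D i) → T) (v : ∀ i, D i)
    (simD : ∀ i, D i → D i → Prop) (simT : T → T → Prop)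
    (i : Fin m)
    (hrel : ∃ A : Finset (Fin m), AXp π v simD simT A ∧ i ∈ A) :
    ∃ C : Finset (Fin m), CXp π v simD simT C ∧ i ∈ C := by
  obtain ⟨A, ⟨hA, hmin⟩, hiA⟩ := hrel
  have hW : WCXp π v simD simT (univ \ A.erase i) := by
    have h := hmin _ (erase_ssubset hiA)
    unfold WAXp at h
    push Not at h
    obtain ⟨x, hx, hxT⟩ := h
    exact ⟨x, fun j hj => hx j (by simpa using hj), hxT⟩
  obtain ⟨C, hCS, hC⟩ := exists_minimal_le_of_wellFoundedLT (WCXp π v simD simT) _ hW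
  refine ⟨C, ⟨hC.prop, fun S hS hWS => hC.not_prop_of_lt hS hWS⟩, ?_⟩
  by_contra hiC
  obtain ⟨y, hy, hyT⟩ := hC.prop
  refine hyT (hA y fun j hj => hy j (mem_sdiff.mpr ⟨mem_univ j, fun hjC => ?_⟩))
  have hji : j ≠ i := fun h => hiC (h ▸ hjC)
  exact (mem_sdiff.mp (hCS hjC)).2 (mem_erase.mpr ⟨hji, hj⟩)
end
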